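/- Representation of localic prenuclear algebras: let L be a frame and ι : L → L a monotone map with a ≤ ι a and ι a ⊓ b ≤ ι(a ⊓ b) for all a, b ∈ L (a prenucleus). Define x R_ι y iff x ≤ ι y. Then: (i) R_ι is reflexive; (ii) whenever x R_ι y, the element z = x ⊓ y satisfies z ≤ y, z ≤ x, and x R_ι z (so R_ι satisfies the prenuclear cover system conditions with respect to the reversed order on L); and (iii) for every a ∈ L, ⟨R_ι⟩{y | y ≤ a} = {y | y ≤ ι a}, where ⟨R_ι⟩X = {x | ∃ y ∈ X, x ≤ ι y}; hence a ↦ {y | y ≤ a} is an isomorphism from (L, ι) onto the propositions of the associated cover system equipped with ⟨R_ι⟩. -/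

import Mathlib

namespace FrameCover

variable {L : Type*} [Order.Frame L]

/-- The operator `⟨R_ι⟩X = {x | ∃ y ∈ X, x R_ι y} = {x | ∃ y ∈ X, x ≤ ι y}`
induced by the relation `x R_ι y ↔ x ≤ ι y`. -/
def diaR (ι : L → L) (X : Set L) : Set L := {x | ∃ y ∈ X, x ≤ ι y}

end FrameCover

open FrameCover in
/-- Representation of localic prenuclear algebras: let `L` be a frame and
`ι : L → L` a prenucleus (monotone, inflationary, `ι a ⊓ b ≤ ι (a ⊓ b)`).
With `x R_ι y ↔ x ≤ ι y`: (i) `R_ι` is reflexive; (ii) whenever `x R_ι y`,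
the element `z = x ⊓ y` satisfies `z ≤ y`, `z ≤ x` and `x R_ι z` (the
prenuclear cover-system conditions for the reversed order); (iii)
`⟨R_ι⟩{y | y ≤ a} = {y | y ≤ ι a}` for every `a`, so that `a ↦ {y | y ≤ a}`
is an isomorphism from `(L, ι)` onto the propositions of the associated
cover system equipped with `⟨R_ι⟩`. -/
theorem frame_prenucleus_representation {L : Type*} [Order.Frame L]
    (ι : L → L) (hmono : Monotone ι)
    (hinfl : ∀ a : L, a ≤ ι a)
    (hpre : ∀ a b : L, ι a ⊓ b ≤ ι (a ⊓ b)) :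
    (∀ x : L, x ≤ ι x) ∧
    (∀ x y : L, x ≤ ι y → x ⊓ y ≤ y ∧ x ⊓ y ≤ x ∧ x ≤ ι (x ⊓ y)) ∧
    (∀ a : L, diaR ι (Set.Iic a) = Set.Iic (ι a)) := by
  refine ⟨hinfl, fun x y h => ⟨inf_le_right, inf_le_left, ?_⟩, fun a => ?_⟩
  · calc x ≤ ι y ⊓ x := le_inf h le_rfl
      _ ≤ ι (y ⊓ x) := hpre y x
      _ = ι (x ⊓ y) := by rw [inf_comm]
  · ext x
    constructor
    · rintro ⟨y, hy, hx⟩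
      exact le_trans hx (hmono hy)
    · intro hx
      exact ⟨a, le_rfl, hx⟩
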